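/- arXiv:1707.02122 — 2 statements merged into one kernel-verified Lean document; each statement's English description precedes it below -/
import Mathlib

section
/- For every sufficiently smooth function v on the closure of M = (0,L)×(-h,0) satisfying ∂_z v = 0 on (0,L)×{0} and (0,L)×{-h}, v = 0 on {0,L}×(-h,0), and ∫_{-h}^{0} v(x,z) dz = 0 for all x, one has ∫_M ( v ∂_x v + Φ(v) ∂_z v ) ∂_{zz} v dx dz = 0, where Φ(v)(x,z) = -∫_{-h}^{z} ∂_x v(x,z') dz'. -/
open MeasureTheory Set

noncomputable section

/-- `Φ(v)(x,z) = -∫_{-h}^z ∂_x v(x,z') dz'`, the diagnosed vertical velocity. -/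
def Phi (h : ℝ) (v : ℝ × ℝ → ℝ) (q : ℝ × ℝ) : ℝ :=
  -∫ z' in (-h)..q.2, fderiv ℝ v (q.1, z') (1, 0)

theorem rect_integrable (L h : ℝ) (g : ℝ × ℝ → ℝ) (hg : Continuous g) :
    IntegrableOn g ((Ioo (0 : ℝ) L) ×ˢ (Ioo (-h) (0 : ℝ))) := by
  have hc : IsCompact ((Icc (0 : ℝ) L) ×ˢ (Icc (-h) (0 : ℝ))) := isCompact_Icc.prod isCompact_Icc
  exact (hg.continuousOn.integrableOn_compact hc).mono_set
    (prod_mono Ioo_subset_Icc_self Ioo_subset_Icc_self)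

theorem ioo_zero (a b : ℝ) (hab : a ≤ b) (G g : ℝ → ℝ) (hg : Continuous g)
    (hG : ∀ z, HasDerivAt G (g z) z) (ha : G a = 0) (hb : G b = 0) :
    ∫ z in Ioo a b, g z = 0 := by
  rw [← integral_Ioc_eq_integral_Ioo, ← intervalIntegral.integral_of_le hab,
    intervalIntegral.integral_eq_sub_of_hasDerivAt (fun z _ => hG z)
      (hg.intervalIntegrable _ _), ha, hb, sub_zero]

theorem int_z (L h : ℝ) (hh : 0 < h) (G g : ℝ × ℝ → ℝ) (hg : Continuous g)
    (hG : ∀ x z, HasDerivAt (fun z => G (x, z)) (g (x, z)) z)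
    (h0 : ∀ x ∈ Icc (0 : ℝ) L, G (x, -h) = 0 ∧ G (x, 0) = 0) :
    ∫ q in (Ioo (0 : ℝ) L) ×ˢ (Ioo (-h) (0 : ℝ)), g q = 0 := by
  have hi := rect_integrable L h g hg
  rw [Measure.volume_eq_prod] at hi ⊢
  rw [setIntegral_prod _ hi]
  refine setIntegral_eq_zero_of_forall_eq_zero fun x hx => ?_
  have hx' := h0 x (Ioo_subset_Icc_self hx)
  exact ioo_zero (-h) 0 (by linarith) (fun z => G (x, z)) (fun z => g (x, z)) (by fun_prop)
    (hG x) hx'.1 hx'.2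

theorem int_x (L h : ℝ) (hL : 0 < L) (G g : ℝ × ℝ → ℝ) (hg : Continuous g)
    (hG : ∀ x z, HasDerivAt (fun x => G (x, z)) (g (x, z)) x)
    (h0 : ∀ z ∈ Icc (-h) (0 : ℝ), G (0, z) = 0 ∧ G (L, z) = 0) :
    ∫ q in (Ioo (0 : ℝ) L) ×ˢ (Ioo (-h) (0 : ℝ)), g q = 0 := by
  have hi := rect_integrable L h g hg
  rw [Measure.volume_eq_prod] at hi ⊢
  rw [IntegrableOn, ← Measure.prod_restrict] at hi
  rw [← Measure.prod_restrict, integral_prod_symm _ hi]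
  refine setIntegral_eq_zero_of_forall_eq_zero fun z hz => ?_
  have hz' := h0 z (Ioo_subset_Icc_self hz)
  exact ioo_zero 0 L hL.le (fun x => G (x, z)) (fun x => g (x, z)) (by fun_prop)
    (fun x => hG x z) hz'.1 hz'.2

theorem slice_z (f : ℝ × ℝ → ℝ) (hf : Differentiable ℝ f) (x z : ℝ) :
    HasDerivAt (fun z => f (x, z)) (fderiv ℝ f (x, z) (0, 1)) z :=
  (hf (x, z)).hasFDerivAt.comp_hasDerivAt z ((hasDerivAt_const z x).prodMk (hasDerivAt_id z))

theorem slice_x (f : ℝ × ℝ → ℝ) (hf : Differentiable ℝ f) (x z : ℝ) :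
    HasDerivAt (fun x => f (x, z)) (fderiv ℝ f (x, z) (1, 0)) x :=
  (hf (x, z)).hasFDerivAt.comp_hasDerivAt x ((hasDerivAt_id x).prodMk (hasDerivAt_const x z))

theorem smooth_partial (f : ℝ × ℝ → ℝ) (hf : ContDiff ℝ (⊤ : ℕ∞) f) (e : ℝ × ℝ) :
    ContDiff ℝ (⊤ : ℕ∞) (fun q => fderiv ℝ f q e) :=
  (hf.fderiv_right (by simp)).clm_apply contDiff_const

theorem partial_symm (f : ℝ × ℝ → ℝ) (hf : ContDiff ℝ (⊤ : ℕ∞) f) (a b q : ℝ × ℝ) :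
    fderiv ℝ (fun w => fderiv ℝ f w a) q b = fderiv ℝ (fun w => fderiv ℝ f w b) q a := by
  have hd : DifferentiableAt ℝ (fderiv ℝ f) q :=
    ((hf.fderiv_right (m := ((⊤ : ℕ∞) : WithTop ℕ∞)) (by simp)).differentiable (by simp)) q
  have hs : IsSymmSndFDerivAt ℝ f q :=
    hf.contDiffAt.isSymmSndFDerivAt (by simp; exact WithTop.coe_le_coe.2 (le_top : (2 : ℕ∞) ≤ ⊤))
  have key : ∀ c d : ℝ × ℝ, fderiv ℝ (fun w => fderiv ℝ f w c) q d
      = fderiv ℝ (fderiv ℝ f) q d c := by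
    intro c d
    have := (hd.hasFDerivAt.clm_apply (hasFDerivAt_const c q)).fderiv
    rw [this]; simp
  rw [key, key]
  exact hs b a

/-- **Lemma 2.1 (3.1)**: for every sufficiently smooth `v` on `M = (0,L) × (-h,0)` with
`∂_z v = 0` on the top and bottom boundaries, `v = 0` on the lateral boundary, and
`∫_{-h}^0 v(x,z) dz = 0`, one has
`∫_M (v ∂_x v + Φ(v) ∂_z v) ∂_{zz} v dx dz = 0`. -/
theorem integral_nonlinear_term_against_dzz_eq_zero
    (L h : ℝ) (hL : 0 < L) (hh : 0 < h)
    (v : ℝ × ℝ → ℝ) (hv : ContDiff ℝ (⊤ : ℕ∞) v)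
    (htop : ∀ x ∈ Icc (0 : ℝ) L, fderiv ℝ v (x, 0) (0, 1) = 0)
    (hbot : ∀ x ∈ Icc (0 : ℝ) L, fderiv ℝ v (x, -h) (0, 1) = 0)
    (hlat : ∀ z ∈ Icc (-h) (0 : ℝ), v (0, z) = 0 ∧ v (L, z) = 0)
    (hmean : ∀ x ∈ Icc (0 : ℝ) L, (∫ z in (-h)..(0 : ℝ), v (x, z)) = 0) :
    ∫ q in (Ioo (0 : ℝ) L) ×ˢ (Ioo (-h) (0 : ℝ)),
      (v q * fderiv ℝ v q (1, 0) + Phi h v q * fderiv ℝ v q (0, 1))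
        * fderiv ℝ (fun w => fderiv ℝ v w (0, 1)) q (0, 1) = 0 := by
  obtain ⟨u, hu⟩ : ∃ u : ℝ × ℝ → ℝ, u = fun q => fderiv ℝ v q (1, 0) := ⟨_, rfl⟩
  obtain ⟨p, hp⟩ : ∃ p : ℝ × ℝ → ℝ, p = fun q => fderiv ℝ v q (0, 1) := ⟨_, rfl⟩
  obtain ⟨px, hpx⟩ : ∃ r : ℝ × ℝ → ℝ, r = fun q => fderiv ℝ p q (1, 0) := ⟨_, rfl⟩
  obtain ⟨pz, hpz⟩ : ∃ r : ℝ × ℝ → ℝ, r = fun q => fderiv ℝ p q (0, 1) := ⟨_, rfl⟩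
  obtain ⟨w, hw⟩ : ∃ r : ℝ × ℝ → ℝ, r = Phi h v := ⟨_, rfl⟩
  have su : ContDiff ℝ (⊤ : ℕ∞) u := hu ▸ smooth_partial v hv _
  have sp : ContDiff ℝ (⊤ : ℕ∞) p := hp ▸ smooth_partial v hv _
  have cpx : Continuous px := hpx ▸ (smooth_partial p sp _).continuous
  have cpz : Continuous pz := hpz ▸ (smooth_partial p sp _).continuous
  have cv := hv.continuous
  have cu := su.continuous
  have cp := sp.continuous
  have huz : ∀ q, fderiv ℝ u q (0, 1) = px q := by
    intro q; rw [hpx, hu, hp]; exact partial_symm v hv _ _ q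
  have hwe : w = fun q => -∫ z' in (-h)..q.2, u (q.1, z') := by
    rw [hw, hu]; rfl
  have cw : Continuous w := by
    rw [hwe]
    refine Continuous.neg ?_
    exact intervalIntegral.continuous_parametric_intervalIntegral_of_continuous
      (f := fun (q : ℝ × ℝ) z' => u (q.1, z')) (by unfold Function.uncurry; fun_prop) continuous_snd
  have dvx : ∀ x z, HasDerivAt (fun x => v (x, z)) (u (x, z)) x := by
    intro x z; rw [hu]; exact slice_x v (hv.differentiable (by simp)) x z
  have dvz : ∀ x z, HasDerivAt (fun z => v (x, z)) (p (x, z)) z := by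
    intro x z; rw [hp]; exact slice_z v (hv.differentiable (by simp)) x z
  have dpx : ∀ x z, HasDerivAt (fun x => p (x, z)) (px (x, z)) x := by
    intro x z; rw [hpx]; exact slice_x p (sp.differentiable (by simp)) x z
  have dpz : ∀ x z, HasDerivAt (fun z => p (x, z)) (pz (x, z)) z := by
    intro x z; rw [hpz]; exact slice_z p (sp.differentiable (by simp)) x z
  have duz : ∀ x z, HasDerivAt (fun z => u (x, z)) (px (x, z)) z := by
    intro x z; rw [← huz]; exact slice_z u (su.differentiable (by simp)) x z
  have dwz : ∀ x z, HasDerivAt (fun z => w (x, z)) (-u (x, z)) z := by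
    intro x z; rw [hwe]
    have c : Continuous fun z' => u (x, z') := by fun_prop
    exact (c.integral_hasStrictDerivAt (-h) z).hasDerivAt.neg
  have pt : ∀ x ∈ Icc (0 : ℝ) L, p (x, -h) = 0 ∧ p (x, 0) = 0 := by
    intro x hx; rw [hp]; exact ⟨hbot x hx, htop x hx⟩
  let g : ℝ × ℝ → ℝ := fun q => p q * u q * p q + v q * px q * p q + v q * u q * pz q
    - 1 / 2 * u q * p q ^ 2 + w q * p q * pz q
  let f : ℝ × ℝ → ℝ := fun q => -(1 / 2) * (u q * p q ^ 2 + 2 * v q * p q * px q)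
  have cg : Continuous g := by fun_prop
  have cf : Continuous f := by fun_prop
  have Ig : ∫ q in (Ioo (0 : ℝ) L) ×ˢ (Ioo (-h) (0 : ℝ)), g q = 0 := by
    refine int_z L h hh (fun q => v q * u q * p q + 1 / 2 * (w q * p q ^ 2)) g cg ?_ ?_
    · intro x z
      refine ((((dvz x z).mul (duz x z)).mul (dpz x z)).add
        (((dwz x z).mul ((dpz x z).pow 2)).const_mul (1 / 2))).congr_deriv ?_
      simp [g]; ring
    · intro x hx
      simp [(pt x hx).1, (pt x hx).2]
  have If : ∫ q in (Ioo (0 : ℝ) L) ×ˢ (Ioo (-h) (0 : ℝ)), f q = 0 := by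
    refine int_x L h hL (fun q => -(1 / 2) * (v q * p q ^ 2)) f cf ?_ ?_
    · intro x z
      refine (((dvx x z).mul ((dpx x z).pow 2)).const_mul (-(1 / 2))).congr_deriv ?_
      simp [f]; ring
    · intro z hz
      simp [(hlat z hz).1, (hlat z hz).2]
  have key : (fun q : ℝ × ℝ =>
      (v q * fderiv ℝ v q (1, 0) + Phi h v q * fderiv ℝ v q (0, 1))
        * fderiv ℝ (fun w => fderiv ℝ v w (0, 1)) q (0, 1)) = fun q => g q + f q := by
    funext q
    have e1 : fderiv ℝ v q (1, 0) = u q := by rw [hu]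
    have e2 : fderiv ℝ v q (0, 1) = p q := by rw [hp]
    have e3 : fderiv ℝ (fun w => fderiv ℝ v w (0, 1)) q (0, 1) = pz q := by rw [hpz, hp]
    rw [e3, e1, e2, ← hw]
    simp only [g, f]; ring
  rw [key, integral_add (rect_integrable L h g cg) (rect_integrable L h f cf), Ig, If, add_zero]
end
end

section
/- There exists a constant C such that for all Y, Ỹ, Ŷ ∈ V with ∂_z Ỹ ∈ H one has |⟨B(Y,Ỹ), Ŷ⟩| ≤ C ‖Ỹ‖ |Y|^{1/2} ‖Y‖^{1/2} |Ŷ|^{1/2} ‖Ŷ‖^{1/2} + C |∂_z Ỹ| ‖Y‖ |Ŷ|^{1/2} ‖Ŷ‖^{1/2}, where |·| and ‖·‖ denote the H-norm and V-norm respectively. -/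
open MeasureTheory Set

noncomputable section

/-- the boundary conditions defining the space of smooth pairs `Y = (v,T)` whose
closures are `H` and `V`: `∂_z v = ∂_z T = 0` on `(0,L) × {0}` and `(0,L) × {-h}`,
`v = 0`, `∂_x T = 0` on `{0,L} × (-h,0)`, and `∫_{-h}^0 v(x,z) dz = 0`. -/
def SatisfiesBC (L h : ℝ) (v T : ℝ × ℝ → ℝ) : Prop :=
  (∀ x ∈ Icc (0 : ℝ) L,
    fderiv ℝ v (x, 0) (0, 1) = 0 ∧ fderiv ℝ T (x, 0) (0, 1) = 0) ∧
  (∀ x ∈ Icc (0 : ℝ) L,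
    fderiv ℝ v (x, -h) (0, 1) = 0 ∧ fderiv ℝ T (x, -h) (0, 1) = 0) ∧
  (∀ z ∈ Icc (-h) (0 : ℝ),
    v (0, z) = 0 ∧ v (L, z) = 0 ∧
      fderiv ℝ T (0, z) (1, 0) = 0 ∧ fderiv ℝ T (L, z) (1, 0) = 0) ∧
  (∀ x ∈ Icc (0 : ℝ) L, (∫ z in (-h)..(0 : ℝ), v (x, z)) = 0)

/-- the trilinear form `⟨B(Y,Ỹ), Ŷ⟩` associated with the nonlinearity of the primitive
equations, written out for smooth pairs. -/
def triB (L h : ℝ) (v T vt Tt vh Th : ℝ × ℝ → ℝ) : ℝ :=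
  ∫ q in (Ioo (0 : ℝ) L) ×ˢ (Ioo (-h) (0 : ℝ)),
    ((v q * fderiv ℝ vt q (1, 0) + Phi h v q * fderiv ℝ vt q (0, 1)) * vh q
      + (v q * fderiv ℝ Tt q (1, 0) + Phi h v q * fderiv ℝ Tt q (0, 1)) * Th q)

/-- the `H = L²(M)²` norm `|Y|` of a pair `Y = (v,T)`. -/
def Hnorm (L h : ℝ) (v T : ℝ × ℝ → ℝ) : ℝ :=
  Real.sqrt (∫ q in (Ioo (0 : ℝ) L) ×ˢ (Ioo (-h) (0 : ℝ)), (v q ^ 2 + T q ^ 2))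

/-- the `V = H¹(M)²` norm `‖Y‖` of a pair `Y = (v,T)` (the Dirichlet norm
`(∫_M |∇v|² + |∇T|²)^{1/2}`, which by the Poincaré inequality is a norm on `V`). -/
def Vnorm (L h : ℝ) (v T : ℝ × ℝ → ℝ) : ℝ :=
  Real.sqrt (∫ q in (Ioo (0 : ℝ) L) ×ˢ (Ioo (-h) (0 : ℝ)),
    (fderiv ℝ v q (1, 0) ^ 2 + fderiv ℝ v q (0, 1) ^ 2
      + fderiv ℝ T q (1, 0) ^ 2 + fderiv ℝ T q (0, 1) ^ 2))

/-- the `H`-norm `|∂_z Y|` of the vertical derivative of a pair `Y = (v,T)`. -/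
def DzHnorm (L h : ℝ) (v T : ℝ × ℝ → ℝ) : ℝ :=
  Real.sqrt (∫ q in (Ioo (0 : ℝ) L) ×ˢ (Ioo (-h) (0 : ℝ)),
    (fderiv ℝ v q (0, 1) ^ 2 + fderiv ℝ T q (0, 1) ^ 2))

abbrev px (f : ℝ × ℝ → ℝ) (q : ℝ × ℝ) : ℝ := fderiv ℝ f q (1, 0)
abbrev pz (f : ℝ × ℝ → ℝ) (q : ℝ × ℝ) : ℝ := fderiv ℝ f q (0, 1)

def rect (L h : ℝ) : Set (ℝ × ℝ) := (Ioo (0 : ℝ) L) ×ˢ (Ioo (-h) (0 : ℝ))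

theorem intOn {L h : ℝ} {f : ℝ × ℝ → ℝ} (hf : Continuous f) :
    IntegrableOn f (rect L h) volume := by
  have : IntegrableOn f (Icc (0 : ℝ) L ×ˢ Icc (-h) (0 : ℝ)) volume :=
    hf.continuousOn.integrableOn_compact (isCompact_Icc.prod isCompact_Icc)
  exact this.mono_set (prod_mono Ioo_subset_Icc_self Ioo_subset_Icc_self)

theorem rect_eq {L h : ℝ} (hL : 0 < L) (hh : 0 < h) {f : ℝ × ℝ → ℝ} (hf : Continuous f) :
    ∫ q in rect L h, f q = ∫ x in (0 : ℝ)..L, ∫ z in (-h)..(0 : ℝ), f (x, z) := by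
  have h1 := intOn (L := L) (h := h) hf
  unfold rect at *
  rw [Measure.volume_eq_prod] at *
  rw [setIntegral_prod _ h1, intervalIntegral.integral_of_le hL.le, integral_Ioc_eq_integral_Ioo]
  congr 1
  ext x
  rw [intervalIntegral.integral_of_le (by linarith), integral_Ioc_eq_integral_Ioo]

theorem rect_eq' {L h : ℝ} (hL : 0 < L) (hh : 0 < h) {f : ℝ × ℝ → ℝ} (hf : Continuous f) :
    ∫ q in rect L h, f q = ∫ z in (-h)..(0 : ℝ), ∫ x in (0 : ℝ)..L, f (x, z) := by
  rw [rect_eq hL hh hf]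
  apply intervalIntegral_intervalIntegral_swap
  have : IntegrableOn f (uIcc (0 : ℝ) L ×ˢ uIcc (-h) (0 : ℝ)) volume :=
    hf.continuousOn.integrableOn_compact (isCompact_uIcc.prod isCompact_uIcc)
  exact this.mono_set (prod_mono uIoc_subset_uIcc uIoc_subset_uIcc)

theorem cs_gen {α : Type*} [MeasurableSpace α] (μ : Measure α) (f g : α → ℝ)
    (hf : Integrable (fun a => f a ^ 2) μ) (hg : Integrable (fun a => g a ^ 2) μ)
    (hfg : Integrable (fun a => f a * g a) μ) :
    (∫ a, f a * g a ∂μ) ^ 2 ≤ (∫ a, f a ^ 2 ∂μ) * (∫ a, g a ^ 2 ∂μ) := by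
  have key : ∀ t : ℝ, 0 ≤ (∫ a, f a ^ 2 ∂μ) * (t * t) + (2 * ∫ a, f a * g a ∂μ) * t
      + ∫ a, g a ^ 2 ∂μ := by
    intro t
    have h0 : 0 ≤ ∫ a, (t * f a + g a) ^ 2 ∂μ := integral_nonneg (fun a => sq_nonneg _)
    have : ∫ a, (t * f a + g a) ^ 2 ∂μ = (∫ a, f a ^ 2 ∂μ) * (t * t)
        + (2 * ∫ a, f a * g a ∂μ) * t + ∫ a, g a ^ 2 ∂μ := by
      have e : (fun a => (t * f a + g a) ^ 2) =
          fun a => (t * t) * f a ^ 2 + (2 * t) * (f a * g a) + g a ^ 2 := by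
        ext a; ring
      have i1 : Integrable (fun a => (t * t) * f a ^ 2 + (2 * t) * (f a * g a)) μ :=
        (hf.const_mul _).add (hfg.const_mul _)
      rw [e, integral_add i1 hg,
        integral_add (hf.const_mul _) (hfg.const_mul _), integral_const_mul, integral_const_mul]
      ring
    linarith
  have := discrim_le_zero key
  unfold discrim at this
  linarith

theorem cs_rect {L h : ℝ} {f g : ℝ × ℝ → ℝ} (hf : Continuous f) (hg : Continuous g) :
    (∫ q in rect L h, f q * g q) ^ 2 ≤ (∫ q in rect L h, f q ^ 2) * (∫ q in rect L h, g q ^ 2) :=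
  cs_gen _ f g (intOn (hf.pow 2)) (intOn (hg.pow 2)) (intOn (hf.mul hg))

theorem cs_int {a b : ℝ} (hab : a ≤ b) {f g : ℝ → ℝ} (hf : Continuous f) (hg : Continuous g) :
    (∫ t in a..b, f t * g t) ^ 2 ≤ (∫ t in a..b, f t ^ 2) * (∫ t in a..b, g t ^ 2) := by
  have i : ∀ {k : ℝ → ℝ}, Continuous k → Integrable k (volume.restrict (Ioc a b)) :=
    fun hk => (hk.intervalIntegrable a b).1
  simp only [intervalIntegral.integral_of_le hab]
  exact cs_gen _ f g (i (hf.pow 2)) (i (hg.pow 2)) (i (hf.mul hg))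

theorem rect_mono {L h : ℝ} {f g : ℝ × ℝ → ℝ} (hf : Continuous f) (hg : Continuous g)
    (H : ∀ q ∈ rect L h, f q ≤ g q) : ∫ q in rect L h, f q ≤ ∫ q in rect L h, g q :=
  setIntegral_mono_on (intOn hf) (intOn hg) (measurableSet_Ioo.prod measurableSet_Ioo) H

theorem rect_nonneg {L h : ℝ} {f : ℝ × ℝ → ℝ} (H : ∀ q, 0 ≤ f q) : 0 ≤ ∫ q in rect L h, f q :=
  integral_nonneg H

theorem contInt {X : Type*} [TopologicalSpace X] {a b : ℝ} {f : X → ℝ → ℝ}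
    (hf : Continuous (fun p : X × ℝ => f p.1 p.2)) : Continuous (fun x => ∫ t in a..b, f x t) :=
  intervalIntegral.continuous_parametric_intervalIntegral_of_continuous' hf a b

section smooth
variable {f : ℝ × ℝ → ℝ}

theorem cpx (hf : ContDiff ℝ 1 f) : Continuous (px f) :=
  (hf.continuous_fderiv one_ne_zero).clm_apply continuous_const
theorem cpz (hf : ContDiff ℝ 1 f) : Continuous (pz f) :=
  (hf.continuous_fderiv one_ne_zero).clm_apply continuous_const

theorem hdx (hf : ContDiff ℝ 1 f) (x z : ℝ) :
    HasDerivAt (fun x => f (x, z)) (px f (x, z)) x := by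
  have h1 := (hf.differentiable one_ne_zero (x, z)).hasFDerivAt
  have h2 : HasDerivAt (fun x : ℝ => (x, z)) (1, 0) x :=
    (hasDerivAt_id x).prodMk (hasDerivAt_const x z)
  exact h1.comp_hasDerivAt x h2
theorem hdz (hf : ContDiff ℝ 1 f) (x z : ℝ) :
    HasDerivAt (fun z => f (x, z)) (pz f (x, z)) z := by
  have h1 := (hf.differentiable one_ne_zero (x, z)).hasFDerivAt
  have h2 : HasDerivAt (fun z : ℝ => (x, z)) (0, 1) z :=
    (hasDerivAt_const z x).prodMk (hasDerivAt_id z)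
  exact h1.comp_hasDerivAt z h2
end smooth

/-- difference bound -/
theorem diff_sq {a b : ℝ} {g g' : ℝ → ℝ} (hg : ∀ t, HasDerivAt g (g' t) t)
    (hc : Continuous g') {s t : ℝ} (hs : s ∈ Icc a b) (ht : t ∈ Icc a b) :
    (g t - g s) ^ 2 ≤ (b - a) * ∫ r in a..b, g' r ^ 2 := by
  wlog hst : s ≤ t generalizing s t
  · have := this ht hs (le_of_not_ge hst)
    nlinarith
  have e : ∫ r in s..t, 1 * g' r = g t - g s := by
    simp only [one_mul]
    exact intervalIntegral.integral_eq_sub_of_hasDerivAt (fun r _ => hg r)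
      (hc.intervalIntegrable _ _)
  rw [← e]
  refine (cs_int hst continuous_const hc).trans ?_
  have h1 : ∫ r in s..t, g' r ^ 2 ≤ ∫ r in a..b, g' r ^ 2 :=
    intervalIntegral.integral_mono_interval hs.1 hst ht.2
      (Filter.Eventually.of_forall fun r => sq_nonneg _) ((hc.pow 2).intervalIntegrable _ _)
  have h2 : 0 ≤ ∫ r in s..t, g' r ^ 2 :=
    intervalIntegral.integral_nonneg hst (fun r _ => sq_nonneg _)
  simp only [one_pow, intervalIntegral.integral_const, smul_eq_mul, mul_one]
  have := hs.1; have := ht.2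
  apply mul_le_mul <;> linarith

/-- one-dimensional trace bound -/
theorem trace_1d {a b : ℝ} (hab : a < b) {g g' : ℝ → ℝ} (hg : ∀ t, HasDerivAt g (g' t) t)
    (hc : Continuous g') {t : ℝ} (ht : t ∈ Icc a b) :
    g t ^ 2 ≤ (1 / (b - a)) * (∫ r in a..b, g r ^ 2) + 2 * ∫ r in a..b, |g r| * |g' r| := by
  have gc : Continuous g := continuous_iff_continuousAt.2 fun t => (hg t).continuousAt
  have pc : Continuous (fun r => |g r| * |g' r|) := gc.abs.mul hc.abs
  have key : ∀ s ∈ Icc a b, g t ^ 2 ≤ g s ^ 2 + 2 * ∫ r in a..b, |g r| * |g' r| := by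
    intro s hs
    have e : ∫ r in s..t, 2 * (g r * g' r) = g t ^ 2 - g s ^ 2 := by
      refine intervalIntegral.integral_eq_sub_of_hasDerivAt (f := fun r => g r ^ 2)
        (fun r _ => ?_) ((continuous_const.mul (gc.mul hc)).intervalIntegrable _ _)
      have := (hg r).fun_pow 2
      simpa [mul_assoc] using this
    have h1 : |∫ r in s..t, 2 * (g r * g' r)| ≤ |∫ r in s..t, 2 * (|g r| * |g' r|)| := by
      have := intervalIntegral.norm_integral_le_abs_integral_norm (μ := volume)
        (f := fun r => 2 * (g r * g' r)) (a := s) (b := t)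
      simpa [abs_mul] using this
    have h2 : |∫ r in s..t, 2 * (|g r| * |g' r|)| ≤ 2 * ∫ r in a..b, |g r| * |g' r| := by
      rw [← intervalIntegral.integral_const_mul]
      have nn : ∀ r, 0 ≤ 2 * (|g r| * |g' r|) := fun r => by positivity
      have := intervalIntegral.abs_integral_mono_interval (μ := volume)
        (f := fun r => 2 * (|g r| * |g' r|)) (a := s) (b := t) (c := a) (d := b)
        (by rw [uIoc_of_le hab.le]; intro r hr; rcases le_total s t with q | q
            · rw [uIoc_of_le q] at hr; exact ⟨hs.1.trans_lt hr.1, hr.2.trans ht.2⟩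
            · rw [uIoc_of_ge q] at hr; exact ⟨ht.1.trans_lt hr.1, hr.2.trans hs.2⟩)
        (Filter.Eventually.of_forall nn) ((continuous_const.mul pc).intervalIntegrable _ _)
      rwa [abs_of_nonneg (a := ∫ r in a..b, 2 * (|g r| * |g' r|))
        (intervalIntegral.integral_nonneg hab.le fun r _ => nn r)] at this
    have h3 := le_abs_self (∫ r in s..t, 2 * (g r * g' r))
    linarith
  have h := intervalIntegral.integral_mono_on hab.le
    (continuous_const.intervalIntegrable (μ := volume) a b)
    (Continuous.intervalIntegrable (by fun_prop) a b) key
  rw [intervalIntegral.integral_add (Continuous.intervalIntegrable (by fun_prop) a b)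
    (continuous_const.intervalIntegrable a b)] at h
  simp only [intervalIntegral.integral_const, smul_eq_mul] at h
  have hp : 0 < b - a := by linarith
  rw [← mul_le_mul_iff_right₀ hp]
  refine h.trans (le_of_eq ?_)
  field_simp

theorem abs_cs {L h : ℝ} {f g : ℝ × ℝ → ℝ} (hf : Continuous f) (hg : Continuous g) :
    |∫ q in rect L h, f q * g q| ≤
      √(∫ q in rect L h, f q ^ 2) * √(∫ q in rect L h, g q ^ 2) := by
  rw [← Real.sqrt_mul (rect_nonneg fun q => sq_nonneg _)]
  exact Real.abs_le_sqrt (cs_rect hf hg)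

theorem abs_cs' {L h : ℝ} {f g : ℝ × ℝ → ℝ} (hf : Continuous f) (hg : Continuous g) :
    ∫ q in rect L h, |f q| * |g q| ≤
      √(∫ q in rect L h, f q ^ 2) * √(∫ q in rect L h, g q ^ 2) := by
  have := (le_abs_self _).trans (abs_cs (L := L) (h := h) hf.abs hg.abs)
  simpa [sq_abs] using this

theorem trace_x {L h : ℝ} (hL : 0 < L) (hh : 0 < h) {f : ℝ × ℝ → ℝ} (hf : ContDiff ℝ 1 f)
    {x : ℝ} (hx : x ∈ Icc 0 L) :
    ∫ z in (-h)..(0 : ℝ), f (x, z) ^ 2 ≤ (1 / L) * (∫ q in rect L h, f q ^ 2)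
      + 2 * (√(∫ q in rect L h, f q ^ 2) * √(∫ q in rect L h, px f q ^ 2)) := by
  have fc := hf.continuous
  have fx := cpx hf
  have c1 : Continuous fun z : ℝ => ∫ r in (0 : ℝ)..L, f (r, z) ^ 2 := contInt (by fun_prop)
  have c2 : Continuous fun z : ℝ => ∫ r in (0 : ℝ)..L, |f (r, z)| * |px f (r, z)| :=
    contInt (by fun_prop)
  have h1 := intervalIntegral.integral_mono_on (a := -h) (b := 0) (μ := volume) (by linarith)
    (f := fun z => f (x, z) ^ 2)
    (g := fun z => (1 / (L - 0)) * (∫ r in (0 : ℝ)..L, f (r, z) ^ 2)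
      + 2 * ∫ r in (0 : ℝ)..L, |f (r, z)| * |px f (r, z)|)
    (Continuous.intervalIntegrable (by fun_prop) _ _)
    (Continuous.intervalIntegrable (by fun_prop) _ _)
    (fun z _ => trace_1d hL (fun t => hdx hf t z) (by fun_prop) hx)
  rw [intervalIntegral.integral_add (Continuous.intervalIntegrable (by fun_prop) _ _)
    (Continuous.intervalIntegrable (by fun_prop) _ _), intervalIntegral.integral_const_mul,
    intervalIntegral.integral_const_mul,
    ← rect_eq' hL hh (f := fun q => f q ^ 2) (by fun_prop),
    ← rect_eq' hL hh (f := fun q => |f q| * |px f q|) (by fun_prop), sub_zero] at h1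
  have := abs_cs' (L := L) (h := h) fc fx
  linarith

def GB (h : ℝ) (f : ℝ × ℝ → ℝ) (x : ℝ) : ℝ :=
  (1 / h) * (∫ z in (-h)..(0 : ℝ), f (x, z) ^ 2)
    + 2 * ∫ z in (-h)..(0 : ℝ), |f (x, z)| * |pz f (x, z)|

theorem GB_cont {h : ℝ} {f : ℝ × ℝ → ℝ} (hf : ContDiff ℝ 1 f) : Continuous (GB h f) := by
  have fc := hf.continuous
  have fx := cpz hf
  have c1 : Continuous fun x : ℝ => ∫ z in (-h)..(0 : ℝ), f (x, z) ^ 2 := contInt (by fun_prop)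
  have c2 : Continuous fun x : ℝ => ∫ z in (-h)..(0 : ℝ), |f (x, z)| * |pz f (x, z)| :=
    contInt (by fun_prop)
  unfold GB
  fun_prop

theorem GB_bound {h : ℝ} (hh : 0 < h) {f : ℝ × ℝ → ℝ} (hf : ContDiff ℝ 1 f) (x z : ℝ)
    (hz : z ∈ Icc (-h) 0) : f (x, z) ^ 2 ≤ GB h f x := by
  have fx := cpz hf
  have := trace_1d (a := -h) (b := 0) (by linarith) (fun t => hdz hf x t) (by fun_prop) hz
  simpa [GB] using this

theorem GB_int {L h : ℝ} (hL : 0 < L) (hh : 0 < h) {f : ℝ × ℝ → ℝ} (hf : ContDiff ℝ 1 f) :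
    ∫ x in (0 : ℝ)..L, GB h f x ≤ (1 / h) * (∫ q in rect L h, f q ^ 2)
      + 2 * (√(∫ q in rect L h, f q ^ 2) * √(∫ q in rect L h, pz f q ^ 2)) := by
  have fc := hf.continuous
  have fx := cpz hf
  have c1 : Continuous fun x : ℝ => ∫ z in (-h)..(0 : ℝ), f (x, z) ^ 2 := contInt (by fun_prop)
  have c2 : Continuous fun x : ℝ => ∫ z in (-h)..(0 : ℝ), |f (x, z)| * |pz f (x, z)| :=
    contInt (by fun_prop)
  unfold GB
  rw [intervalIntegral.integral_add (Continuous.intervalIntegrable (by fun_prop) _ _)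
    (Continuous.intervalIntegrable (by fun_prop) _ _), intervalIntegral.integral_const_mul,
    intervalIntegral.integral_const_mul,
    ← rect_eq hL hh (f := fun q => f q ^ 2) (by fun_prop),
    ← rect_eq hL hh (f := fun q => |f q| * |pz f q|) (by fun_prop)]
  have := abs_cs' (L := L) (h := h) fc fx
  linarith

/-- the basic trilinear bound -/
theorem tri_bound {L h : ℝ} (hL : 0 < L) (hh : 0 < h) {F g w : ℝ × ℝ → ℝ} {G : ℝ → ℝ} {S : ℝ}
    (hF : Continuous F) (hg : Continuous g) (hw : Continuous w) (hG : Continuous G)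
    (hFG : ∀ x ∈ Icc 0 L, ∀ z ∈ Icc (-h) 0, F (x, z) ^ 2 ≤ G x)
    (hS : ∀ x ∈ Icc 0 L, ∫ z in (-h)..(0 : ℝ), w (x, z) ^ 2 ≤ S) :
    |∫ q in rect L h, F q * g q * w q| ≤
      √(∫ q in rect L h, g q ^ 2) * √((∫ x in (0 : ℝ)..L, G x) * S) := by
  have e : (fun q => F q * g q * w q) = fun q => g q * (F q * w q) := by ext q; ring
  rw [e]
  refine (abs_cs hg (hF.mul hw)).trans ?_
  refine mul_le_mul_of_nonneg_left (Real.sqrt_le_sqrt ?_) (Real.sqrt_nonneg _)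
  have c1 : Continuous fun x : ℝ => ∫ z in (-h)..(0 : ℝ), w (x, z) ^ 2 := contInt (by fun_prop)
  calc ∫ q in rect L h, (F q * w q) ^ 2 ≤ ∫ q in rect L h, G q.1 * w q ^ 2 := by
        refine rect_mono (by fun_prop) (by fun_prop) ?_
        rintro ⟨x, z⟩ ⟨hx, hz⟩
        rw [mul_pow]
        exact mul_le_mul_of_nonneg_right (hFG x (Ioo_subset_Icc_self hx) z
          (Ioo_subset_Icc_self hz)) (sq_nonneg _)
    _ = ∫ x in (0 : ℝ)..L, G x * ∫ z in (-h)..(0 : ℝ), w (x, z) ^ 2 := by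
        rw [rect_eq hL hh (by fun_prop)]
        simp only [intervalIntegral.integral_const_mul]
    _ ≤ ∫ x in (0 : ℝ)..L, G x * S := by
        refine intervalIntegral.integral_mono_on hL.le
          (Continuous.intervalIntegrable (by fun_prop) _ _)
          (Continuous.intervalIntegrable (by fun_prop) _ _) (fun x hx => ?_)
        refine mul_le_mul_of_nonneg_left (hS x hx) ?_
        exact (sq_nonneg _).trans (hFG x hx 0 ⟨by linarith, le_refl _⟩)
    _ = (∫ x in (0 : ℝ)..L, G x) * S := intervalIntegral.integral_mul_const _ _

/-- Poincaré for functions vanishing at `x = 0` -/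
theorem poin_zero {L h : ℝ} (hL : 0 < L) (hh : 0 < h) {f : ℝ × ℝ → ℝ} (hf : ContDiff ℝ 1 f)
    (h0 : ∀ z ∈ Icc (-h) 0, f (0, z) = 0) :
    ∫ q in rect L h, f q ^ 2 ≤ L ^ 2 * ∫ q in rect L h, px f q ^ 2 := by
  have fc := hf.continuous
  have fx := cpx hf
  have c1 : Continuous fun z : ℝ => ∫ r in (0 : ℝ)..L, px f (r, z) ^ 2 := contInt (by fun_prop)
  have c3 : Continuous fun q : ℝ × ℝ => L * ∫ r in (0 : ℝ)..L, px f (r, q.2) ^ 2 :=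
    continuous_const.mul (c1.comp continuous_snd)
  calc ∫ q in rect L h, f q ^ 2
      ≤ ∫ q in rect L h, L * ∫ r in (0 : ℝ)..L, px f (r, q.2) ^ 2 := by
        refine rect_mono (by fun_prop) c3 ?_
        rintro ⟨x, z⟩ ⟨hx, hz⟩
        have := diff_sq (a := 0) (b := L) (fun t => hdx hf t z) (by fun_prop)
          ⟨le_refl _, hL.le⟩ (Ioo_subset_Icc_self hx)
        rw [h0 z (Ioo_subset_Icc_self hz)] at this
        simpa using this
    _ = L ^ 2 * ∫ q in rect L h, px f q ^ 2 := by
        rw [rect_eq' hL hh c3,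
          rect_eq' hL hh (by fun_prop)]
        simp only [intervalIntegral.integral_const, smul_eq_mul,
          intervalIntegral.integral_const_mul]
        ring

theorem rect_const {L h : ℝ} (hL : 0 < L) (hh : 0 < h) (c : ℝ) :
    ∫ _q in rect L h, c = L * h * c := by
  rw [rect_eq hL hh continuous_const]
  simp; ring

/-- Poincaré for mean-zero functions -/
theorem poin_mean {L h : ℝ} (hL : 0 < L) (hh : 0 < h) {f : ℝ × ℝ → ℝ} (hf : ContDiff ℝ 1 f)
    (h0 : ∫ q in rect L h, f q = 0) :
    ∫ q in rect L h, f q ^ 2 ≤ 2 * L ^ 2 * (∫ q in rect L h, px f q ^ 2)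
      + 2 * h ^ 2 * (∫ q in rect L h, pz f q ^ 2) := by
  have fc := hf.continuous
  have fx := cpx hf
  have fz := cpz hf
  set A : ℝ → ℝ := fun z => ∫ r in (0 : ℝ)..L, px f (r, z) ^ 2 with hA
  set B : ℝ → ℝ := fun x => ∫ z in (-h)..(0 : ℝ), pz f (x, z) ^ 2 with hB
  have c1 : Continuous A := contInt (by fun_prop)
  have c2 : Continuous B := contInt (by fun_prop)
  have hLh : 0 < L * h := by positivity
  have eA : ∫ q in rect L h, A q.2 = L * ∫ q in rect L h, px f q ^ 2 := by
    rw [rect_eq' hL hh (by fun_prop), rect_eq' hL hh (by fun_prop)]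
    simp only [intervalIntegral.integral_const, smul_eq_mul,
          intervalIntegral.integral_const_mul, hA]
    ring
  have eB : ∫ q in rect L h, B q.1 = h * ∫ q in rect L h, pz f q ^ 2 := by
    rw [rect_eq hL hh (by fun_prop), rect_eq hL hh (by fun_prop)]
    simp only [intervalIntegral.integral_const, smul_eq_mul,
          intervalIntegral.integral_const_mul, hB]
    ring
  have pt : ∀ q ∈ rect L h, L * h * f q ^ 2 ≤
      2 * L * (L * h) * A q.2 + 2 * h * (h * ∫ q in rect L h, pz f q ^ 2) := by
    rintro ⟨x, z⟩ ⟨hx, hz⟩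
    have m := rect_mono (L := L) (h := h) (f := fun q => f (x, z) ^ 2 - 2 * f (x, z) * f q)
      (g := fun q => 2 * L * A z + 2 * h * B q.1) (by fun_prop) (by fun_prop) (by
        rintro ⟨x', z'⟩ ⟨hx', hz'⟩
        have d1 := diff_sq (a := 0) (b := L) (fun t => hdx hf t z) (by fun_prop)
          (Ioo_subset_Icc_self hx') (Ioo_subset_Icc_self hx)
        have d2 := diff_sq (a := -h) (b := 0) (fun t => hdz hf x' t) (by fun_prop)
          (Ioo_subset_Icc_self hz') (Ioo_subset_Icc_self hz)
        simp only [sub_zero, zero_sub, neg_neg] at d1 d2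
        change _ ≤ L * A z at d1
        change _ ≤ h * B x' at d2
        simp only
        nlinarith [sq_nonneg ((f (x, z) - f (x', z)) - (f (x', z) - f (x', z'))),
          sq_nonneg (f (x', z'))])
    rw [integral_sub (intOn (by fun_prop)) (intOn (by fun_prop)), integral_const_mul, h0,
      integral_add (intOn (by fun_prop)) (intOn (by fun_prop)), integral_const_mul, integral_const_mul, eB,
      rect_const hL hh, rect_const hL hh] at m
    simp only
    linarith
  have m := rect_mono (L := L) (h := h) (by fun_prop) (by fun_prop) pt
  rw [integral_add (intOn (by fun_prop)) (intOn (by fun_prop)), integral_const_mul,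
    integral_const_mul, eA, rect_const hL hh] at m
  rw [← mul_le_mul_iff_right₀ hLh]
  linarith

theorem Phi_cont {h : ℝ} {v : ℝ × ℝ → ℝ} (hv : ContDiff ℝ 1 v) : Continuous (Phi h v) := by
  have fx := cpx hv
  have := intervalIntegral.continuous_parametric_intervalIntegral_of_continuous (μ := volume)
    (f := fun (q : ℝ × ℝ) z' => px v (q.1, z')) (a₀ := -h) (s := fun q => q.2)
    (by unfold Function.uncurry; fun_prop) continuous_snd
  exact this.neg

theorem Phi_bound {h : ℝ} {v : ℝ × ℝ → ℝ} (hv : ContDiff ℝ 1 v) (x z : ℝ)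
    (hz : z ∈ Icc (-h) 0) :
    Phi h v (x, z) ^ 2 ≤ h * ∫ r in (-h)..(0 : ℝ), px v (x, r) ^ 2 := by
  have fx := cpx hv
  have hd : ∀ t, HasDerivAt (fun t => ∫ r in (-h)..t, px v (x, r)) (px v (x, t)) t := fun t =>
    (Continuous.integral_hasStrictDerivAt (f := fun r => px v (x, r)) (by fun_prop) _ _).hasDerivAt
  have := diff_sq (a := -h) (b := 0) hd (by fun_prop) ⟨le_refl _, hz.1.trans hz.2⟩ hz
  simpa [Phi] using this

theorem Phi_top {L h : ℝ} (hL : 0 < L) (hh : 0 < h) {v : ℝ × ℝ → ℝ} (hv : ContDiff ℝ 1 v)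
    (h0 : ∀ x ∈ Icc (0 : ℝ) L, (∫ z in (-h)..(0 : ℝ), v (x, z)) = 0) {x : ℝ}
    (hx : x ∈ Ioo 0 L) : ∫ z in (-h)..(0 : ℝ), px v (x, z) = 0 := by
  have fc := hv.continuous
  have fx := cpx hv
  have c1 : Continuous fun x : ℝ => ∫ z in (-h)..(0 : ℝ), px v (x, z) := contInt (by fun_prop)
  have hd := (Continuous.integral_hasStrictDerivAt c1 0 x).hasDerivAt
  have ev : (fun t => ∫ x in (0 : ℝ)..t, ∫ z in (-h)..(0 : ℝ), px v (x, z)) =ᶠ[nhds x]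
      fun _ => (0 : ℝ) := by
    filter_upwards [Ioo_mem_nhds hx.1 hx.2] with t ht
    rw [← rect_eq ht.1 hh (by fun_prop), rect_eq' ht.1 hh (by fun_prop)]
    have : ∀ z, ∫ x in (0 : ℝ)..t, px v (x, z) = v (t, z) - v (0, z) := fun z =>
      intervalIntegral.integral_eq_sub_of_hasDerivAt (fun r _ => hdx hv r z)
        (Continuous.intervalIntegrable (by fun_prop) _ _)
    simp only [this]
    rw [intervalIntegral.integral_sub (Continuous.intervalIntegrable (by fun_prop) _ _)
      (Continuous.intervalIntegrable (by fun_prop) _ _), h0 t ⟨ht.1.le, ht.2.le⟩,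
      h0 0 ⟨le_refl _, hL.le⟩, sub_zero]
  exact (hd.congr_of_eventuallyEq ev.symm).unique (hasDerivAt_const x (0 : ℝ))

theorem div_free {L h : ℝ} (hL : 0 < L) (hh : 0 < h) {v g : ℝ × ℝ → ℝ} (hv : ContDiff ℝ 1 v)
    (hg : ContDiff ℝ 1 g)
    (h0 : ∀ x ∈ Icc (0 : ℝ) L, (∫ z in (-h)..(0 : ℝ), v (x, z)) = 0)
    (h1 : ∀ z ∈ Icc (-h) (0 : ℝ), v (0, z) = 0 ∧ v (L, z) = 0) :
    ∫ q in rect L h, (v q * px g q + Phi h v q * pz g q) = 0 := by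
  have vc := hv.continuous
  have vx := cpx hv
  have gc := hg.continuous
  have gx := cpx hg
  have gz := cpz hg
  have pc := Phi_cont (h := h) hv
  rw [integral_add (intOn (by fun_prop)) (intOn (by fun_prop))]
  have e1 : ∫ q in rect L h, v q * px g q = - ∫ q in rect L h, px v q * g q := by
    rw [rect_eq' hL hh (by fun_prop), rect_eq' hL hh (by fun_prop),
      ← intervalIntegral.integral_neg]
    apply intervalIntegral.integral_congr
    intro z hz
    rw [uIcc_of_le (by linarith)] at hz
    simp only
    rw [intervalIntegral.integral_mul_deriv_eq_deriv_mul (fun x _ => hdx hv x z)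
      (fun x _ => hdx hg x z) (Continuous.intervalIntegrable (by fun_prop) _ _)
      (Continuous.intervalIntegrable (by fun_prop) _ _), (h1 z hz).1, (h1 z hz).2]
    ring
  have e2 : ∫ q in rect L h, Phi h v q * pz g q = ∫ q in rect L h, px v q * g q := by
    rw [rect_eq hL hh (by fun_prop), rect_eq hL hh (by fun_prop)]
    simp only [intervalIntegral.integral_of_le hL.le, integral_Ioc_eq_integral_Ioo]
    refine setIntegral_congr_fun measurableSet_Ioo (fun x hx => ?_)
    have hd : ∀ t, HasDerivAt (fun t => Phi h v (x, t)) (- px v (x, t)) t := fun t =>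
      (Continuous.integral_hasStrictDerivAt (f := fun r => px v (x, r))
        (by fun_prop) _ _).hasDerivAt.neg
    rw [intervalIntegral.integral_mul_deriv_eq_deriv_mul (fun t _ => hd t)
      (fun t _ => hdz hg x t) (Continuous.intervalIntegrable (by fun_prop) _ _)
      (Continuous.intervalIntegrable (by fun_prop) _ _)]
    have t0 : Phi h v (x, 0) = 0 := by
      have := Phi_top hL hh hv h0 hx
      simp only [Phi, neg_eq_zero]; exact this
    have t1 : Phi h v (x, -h) = 0 := by simp [Phi]
    rw [t0, t1]
    simp
  rw [e1, e2]; ring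

def KK (L h : ℝ) : ℝ := 2 * (L + h) / L + 2 * (L + h) / h + 2

theorem good {L h : ℝ} (hL : 0 < L) (hh : 0 < h) {w : ℝ × ℝ → ℝ} (hw : ContDiff ℝ 1 w)
    (hP : ∫ q in rect L h, w q ^ 2 ≤ (2 * (L + h)) ^ 2 *
      ((∫ q in rect L h, px w q ^ 2) + ∫ q in rect L h, pz w q ^ 2))
    {H V : ℝ} (hH : 0 ≤ H) (hV : 0 ≤ V) (h1 : ∫ q in rect L h, w q ^ 2 ≤ H ^ 2)
    (h2 : (∫ q in rect L h, px w q ^ 2) + (∫ q in rect L h, pz w q ^ 2) ≤ V ^ 2) :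
    (∀ x ∈ Icc 0 L, ∫ z in (-h)..(0 : ℝ), w (x, z) ^ 2 ≤ KK L h * H * V) ∧
      ∫ x in (0 : ℝ)..L, GB h w x ≤ KK L h * H * V := by
  have nx : 0 ≤ ∫ q in rect L h, px w q ^ 2 := rect_nonneg fun q => sq_nonneg _
  have nz : 0 ≤ ∫ q in rect L h, pz w q ^ 2 := rect_nonneg fun q => sq_nonneg _
  have nw : 0 ≤ ∫ q in rect L h, w q ^ 2 := rect_nonneg fun q => sq_nonneg _
  have a1 : √(∫ q in rect L h, w q ^ 2) ≤ H := Real.sqrt_le_iff.2 ⟨hH, h1⟩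
  have a2 : √(∫ q in rect L h, w q ^ 2) ≤ 2 * (L + h) * V := by
    refine Real.sqrt_le_iff.2 ⟨by positivity, hP.trans ?_⟩
    rw [mul_pow (2 * (L + h)) V]
    exact mul_le_mul_of_nonneg_left h2 (by positivity)
  have a3 : √(∫ q in rect L h, px w q ^ 2) ≤ V := Real.sqrt_le_iff.2 ⟨hV, by linarith⟩
  have a4 : √(∫ q in rect L h, pz w q ^ 2) ≤ V := Real.sqrt_le_iff.2 ⟨hV, by linarith⟩
  have a5 : ∫ q in rect L h, w q ^ 2 ≤ H * (2 * (L + h) * V) := by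
    rw [← Real.mul_self_sqrt nw]
    exact mul_le_mul a1 a2 (Real.sqrt_nonneg _) hH
  have a6 := mul_le_mul a1 a3 (Real.sqrt_nonneg _) hH
  have a7 := mul_le_mul a1 a4 (Real.sqrt_nonneg _) hH
  have b1 : (1 / L) * (∫ q in rect L h, w q ^ 2) ≤ (1 / L) * (H * (2 * (L + h) * V)) :=
    mul_le_mul_of_nonneg_left a5 (by positivity)
  have b2 : (1 / h) * (∫ q in rect L h, w q ^ 2) ≤ (1 / h) * (H * (2 * (L + h) * V)) :=
    mul_le_mul_of_nonneg_left a5 (by positivity)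
  have c1 : 0 ≤ (1 / L) * (H * (2 * (L + h) * V)) := by positivity
  have c2 : 0 ≤ (1 / h) * (H * (2 * (L + h) * V)) := by positivity
  have e : KK L h * H * V = (1 / L) * (H * (2 * (L + h) * V)) + (1 / h) * (H * (2 * (L + h) * V))
      + 2 * (H * V) := by unfold KK; ring
  rw [e]
  constructor
  · intro x hx
    have := trace_x hL hh hw hx
    linarith
  · have := GB_int hL hh hw
    linarith

theorem poin_zero' {L h : ℝ} (hL : 0 < L) (hh : 0 < h) {f : ℝ × ℝ → ℝ} (hf : ContDiff ℝ 1 f)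
    (h0 : ∀ z ∈ Icc (-h) 0, f (0, z) = 0) :
    ∫ q in rect L h, f q ^ 2 ≤ (2 * (L + h)) ^ 2 *
      ((∫ q in rect L h, px f q ^ 2) + ∫ q in rect L h, pz f q ^ 2) := by
  have nx : 0 ≤ ∫ q in rect L h, px f q ^ 2 := rect_nonneg fun q => sq_nonneg _
  have nz : 0 ≤ ∫ q in rect L h, pz f q ^ 2 := rect_nonneg fun q => sq_nonneg _
  refine (poin_zero hL hh hf h0).trans ?_
  refine mul_le_mul ?_ (by linarith) nx (by positivity)
  exact pow_le_pow_left₀ hL.le (by linarith) 2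

theorem exists_shift {L h : ℝ} (hL : 0 < L) (hh : 0 < h) {f : ℝ × ℝ → ℝ}
    (hf : ContDiff ℝ 1 f) : ∃ c : ℝ, ContDiff ℝ 1 (fun q => f q - c) ∧
      (∫ q in rect L h, (f q - c) ^ 2 ≤ ∫ q in rect L h, f q ^ 2) ∧
      ∫ q in rect L h, (f q - c) ^ 2 ≤ (2 * (L + h)) ^ 2 *
      ((∫ q in rect L h, px (fun q => f q - c) q ^ 2)
        + ∫ q in rect L h, pz (fun q => f q - c) q ^ 2) := by
  have fc := hf.continuous
  set c := (∫ q in rect L h, f q) / (L * h) with hc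
  have hLh : 0 < L * h := by positivity
  have ec : ∫ q in rect L h, f q = L * h * c := by rw [hc]; field_simp
  have cd : ContDiff ℝ 1 (fun q => f q - c) := hf.sub contDiff_const
  refine ⟨c, cd, ?_, ?_⟩
  · have e : (fun q => (f q - c) ^ 2) = fun q => (f q ^ 2 - 2 * c * f q) + c ^ 2 := by
      ext q; ring
    rw [e, integral_add (intOn (by fun_prop)) (intOn (by fun_prop)),
      integral_sub (intOn (by fun_prop)) (intOn (by fun_prop)), integral_const_mul, ec,
      rect_const hL hh]
    have : 0 ≤ L * h * c ^ 2 := by positivity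
    linarith
  · have h0 : ∫ q in rect L h, (f q - c) = 0 := by
      rw [integral_sub (intOn (by fun_prop)) (intOn (by fun_prop)), ec, rect_const hL hh, sub_self]
    refine (poin_mean hL hh cd h0).trans ?_
    rw [mul_add]
    have nx : 0 ≤ ∫ q in rect L h, px (fun q => f q - c) q ^ 2 := rect_nonneg fun q => sq_nonneg _
    have nz : 0 ≤ ∫ q in rect L h, pz (fun q => f q - c) q ^ 2 := rect_nonneg fun q => sq_nonneg _
    exact add_le_add (mul_le_mul_of_nonneg_right (by nlinarith) nx)
      (mul_le_mul_of_nonneg_right (by nlinarith) nz)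

theorem norms_bd {L h : ℝ} {v T : ℝ × ℝ → ℝ} (hv : ContDiff ℝ 1 v) (hT : ContDiff ℝ 1 T) :
    0 ≤ Hnorm L h v T ∧ 0 ≤ Vnorm L h v T ∧ 0 ≤ DzHnorm L h v T ∧ True ∧
    (∫ q in rect L h, v q ^ 2 ≤ Hnorm L h v T ^ 2) ∧
    ((∫ q in rect L h, px v q ^ 2) + (∫ q in rect L h, pz v q ^ 2) ≤ Vnorm L h v T ^ 2) ∧
    (∫ q in rect L h, T q ^ 2 ≤ Hnorm L h v T ^ 2) ∧
    ((∫ q in rect L h, px T q ^ 2) + (∫ q in rect L h, pz T q ^ 2) ≤ Vnorm L h v T ^ 2) ∧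
    (∫ q in rect L h, pz v q ^ 2 ≤ DzHnorm L h v T ^ 2) ∧
    (∫ q in rect L h, pz T q ^ 2 ≤ DzHnorm L h v T ^ 2) := by
  have vc := hv.continuous
  have vx := cpx hv
  have vz := cpz hv
  have Tc := hT.continuous
  have Tx := cpx hT
  have Tz := cpz hT
  have eH : Hnorm L h v T ^ 2 = (∫ q in rect L h, v q ^ 2) + ∫ q in rect L h, T q ^ 2 := by
    rw [← integral_add (intOn (by fun_prop)) (intOn (by fun_prop))]
    exact Real.sq_sqrt (rect_nonneg fun q => by positivity)
  have eV : Vnorm L h v T ^ 2 = (∫ q in rect L h, px v q ^ 2) + (∫ q in rect L h, pz v q ^ 2)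
      + (∫ q in rect L h, px T q ^ 2) + (∫ q in rect L h, pz T q ^ 2) := by
    rw [← integral_add (intOn (by fun_prop)) (intOn (by fun_prop)),
      ← integral_add (intOn (by fun_prop)) (intOn (by fun_prop)),
      ← integral_add (intOn (by fun_prop)) (intOn (by fun_prop))]
    exact Real.sq_sqrt (rect_nonneg fun q => by positivity)
  have eD : DzHnorm L h v T ^ 2 = (∫ q in rect L h, pz v q ^ 2)
      + (∫ q in rect L h, pz T q ^ 2) := by
    rw [← integral_add (intOn (by fun_prop)) (intOn (by fun_prop))]
    exact Real.sq_sqrt (rect_nonneg fun q => by positivity)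
  have i1 : 0 ≤ ∫ q in rect L h, v q ^ 2 := rect_nonneg fun q => sq_nonneg _
  have i2 : 0 ≤ ∫ q in rect L h, T q ^ 2 := rect_nonneg fun q => sq_nonneg _
  have i3 : 0 ≤ ∫ q in rect L h, px v q ^ 2 := rect_nonneg fun q => sq_nonneg _
  have i4 : 0 ≤ ∫ q in rect L h, pz v q ^ 2 := rect_nonneg fun q => sq_nonneg _
  have i5 : 0 ≤ ∫ q in rect L h, px T q ^ 2 := rect_nonneg fun q => sq_nonneg _
  have i6 : 0 ≤ ∫ q in rect L h, pz T q ^ 2 := rect_nonneg fun q => sq_nonneg _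
  refine ⟨Real.sqrt_nonneg _, Real.sqrt_nonneg _, Real.sqrt_nonneg _, trivial, ?_, ?_, ?_, ?_,
    ?_, ?_⟩ <;> linarith

/-- **Lemma 3.1 (3.3)**: there is a constant `C` such that for all `Y, Ỹ, Ŷ ∈ V` with
`∂_z Ỹ ∈ H`,
`|⟨B(Y,Ỹ), Ŷ⟩| ≤ C ‖Ỹ‖ |Y|^{1/2} ‖Y‖^{1/2} |Ŷ|^{1/2} ‖Ŷ‖^{1/2}
  + C |∂_z Ỹ| ‖Y‖ |Ŷ|^{1/2} ‖Ŷ‖^{1/2}`. -/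
theorem triB_estimate (L h : ℝ) (hL : 0 < L) (hh : 0 < h) :
    ∃ C : ℝ, 0 < C ∧
      ∀ v T vt Tt vh Th : ℝ × ℝ → ℝ,
        ContDiff ℝ (⊤ : ℕ∞) v → ContDiff ℝ (⊤ : ℕ∞) T → ContDiff ℝ (⊤ : ℕ∞) vt → ContDiff ℝ (⊤ : ℕ∞) Tt →
        ContDiff ℝ (⊤ : ℕ∞) vh → ContDiff ℝ (⊤ : ℕ∞) Th →
        SatisfiesBC L h v T → SatisfiesBC L h vt Tt → SatisfiesBC L h vh Th →
        |triB L h v T vt Tt vh Th|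
          ≤ C * Vnorm L h vt Tt
              * Real.sqrt (Hnorm L h v T) * Real.sqrt (Vnorm L h v T)
              * Real.sqrt (Hnorm L h vh Th) * Real.sqrt (Vnorm L h vh Th)
            + C * DzHnorm L h vt Tt * Vnorm L h v T
              * Real.sqrt (Hnorm L h vh Th) * Real.sqrt (Vnorm L h vh Th) := by
  set K : ℝ := KK L h with hK
  have K0 : 0 < K := by rw [hK]; unfold KK; positivity
  refine ⟨2 * K + 2 * √(h * K), by positivity, ?_⟩
  intro v T vt Tt vh Th hv hT hvt hTt hvh hTh b1 _ b3
  replace hv := hv.of_le (m := 1) (by exact_mod_cast le_top)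
  replace hT := hT.of_le (m := 1) (by exact_mod_cast le_top)
  replace hvt := hvt.of_le (m := 1) (by exact_mod_cast le_top)
  replace hTt := hTt.of_le (m := 1) (by exact_mod_cast le_top)
  replace hvh := hvh.of_le (m := 1) (by exact_mod_cast le_top)
  replace hTh := hTh.of_le (m := 1) (by exact_mod_cast le_top)
  obtain ⟨-, -, b1a, b1b⟩ := b1
  obtain ⟨-, -, b3a, -⟩ := b3
  have n1 := norms_bd (L := L) (h := h) hv hT
  have n2 := norms_bd (L := L) (h := h) hvt hTt
  have n3 := norms_bd (L := L) (h := h) hvh hTh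
  -- pieces
  obtain ⟨c, φc, φn, φp⟩ := exists_shift hL hh hTh
  set φ : ℝ × ℝ → ℝ := fun q => Th q - c with hφ
  have φx : px φ = px Th := by ext q; simp [px, hφ, fderiv_sub_const]
  have φz : pz φ = pz Th := by ext q; simp [pz, hφ, fderiv_sub_const]
  have gv := good hL hh hv (poin_zero' hL hh hv fun z hz => (b1a z hz).1)
    n1.1 n1.2.1 n1.2.2.2.2.1 n1.2.2.2.2.2.1
  have gvh := good hL hh hvh (poin_zero' hL hh hvh fun z hz => (b3a z hz).1)
    n3.1 n3.2.1 n3.2.2.2.2.1 n3.2.2.2.2.2.1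
  have gφ := good hL hh φc φp n3.1 n3.2.1 (φn.trans n3.2.2.2.2.2.2.1)
    (by rw [φx, φz]; exact n3.2.2.2.2.2.2.2.1)
  set H := Hnorm L h v T
  set V := Vnorm L h v T
  set Hh := Hnorm L h vh Th
  set Vh := Vnorm L h vh Th
  set Vt := Vnorm L h vt Tt
  set D := DzHnorm L h vt Tt
  have p1 : 0 ≤ H := n1.1
  have p2 : 0 ≤ V := n1.2.1
  have p3 : 0 ≤ Hh := n3.1
  have p4 : 0 ≤ Vh := n3.2.1
  have p5 : 0 ≤ Vt := n2.2.1
  have p6 : 0 ≤ D := n2.2.2.1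
  have cv := hv.continuous
  have cvx := cpx hv
  have cvh := hvh.continuous
  have cTh := hTh.continuous
  have cφ := φc.continuous
  have cPhi := Phi_cont (h := h) hv
  have cvtx := cpx hvt
  have cvtz := cpz hvt
  have cTtx := cpx hTt
  have cTtz := cpz hTt
  -- decomposition
  have dec : triB L h v T vt Tt vh Th =
      (∫ q in rect L h, v q * px vt q * vh q) + (∫ q in rect L h, Phi h v q * pz vt q * vh q)
      + ((∫ q in rect L h, v q * px Tt q * φ q)
        + (∫ q in rect L h, Phi h v q * pz Tt q * φ q)) := by
    have e : triB L h v T vt Tt vh Th = ∫ q in rect L h,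
        (((v q * px vt q * vh q + Phi h v q * pz vt q * vh q) +
        (v q * px Tt q * φ q + Phi h v q * pz Tt q * φ q))
        + c * (v q * px Tt q + Phi h v q * pz Tt q)) := by
      unfold triB rect
      congr 1
      ext q
      simp only [px, pz, hφ]
      ring
    rw [e, integral_add (intOn (by fun_prop)) (intOn (by fun_prop)), integral_const_mul,
      div_free hL hh hv hTt b1b (fun z hz => ⟨(b1a z hz).1, (b1a z hz).2.1⟩),
      integral_add (intOn (by fun_prop)) (intOn (by fun_prop)),
      integral_add (intOn (by fun_prop)) (intOn (by fun_prop)),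
      integral_add (intOn (by fun_prop)) (intOn (by fun_prop))]
    ring
  have s0 : K * H * V * (K * Hh * Vh) = (K * √H * √V * √Hh * √Vh) ^ 2 := by
    simp only [mul_pow, Real.sq_sqrt, p1, p2, p3, p4]; ring
  have bx : ∀ (g w : ℝ × ℝ → ℝ), Continuous g → Continuous w →
      (∀ x ∈ Icc 0 L, ∫ z in (-h)..(0 : ℝ), w (x, z) ^ 2 ≤ K * Hh * Vh) →
      √(∫ q in rect L h, g q ^ 2) ≤ Vt →
      |∫ q in rect L h, v q * g q * w q| ≤ Vt * (K * √H * √V * √Hh * √Vh) := by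
    intro g w hg hw hS hgV
    refine (tri_bound hL hh cv hg hw (GB_cont (h := h) hv)
      (fun x _ z hz => GB_bound hh hv x z hz) hS).trans ?_
    refine mul_le_mul hgV ?_ (Real.sqrt_nonneg _) p5
    rw [← Real.sqrt_sq (show 0 ≤ K * √H * √V * √Hh * √Vh by positivity), ← s0]
    exact Real.sqrt_le_sqrt (mul_le_mul_of_nonneg_right gv.2 (by positivity))
  have s1 : h * V ^ 2 * (K * Hh * Vh) = (√(h * K) * V * √Hh * √Vh) ^ 2 := by
    simp only [mul_pow]
    rw [Real.sq_sqrt p3, Real.sq_sqrt p4, Real.sq_sqrt (by positivity)]; ring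
  have cG : Continuous fun x => h * ∫ r in (-h)..(0 : ℝ), px v (x, r) ^ 2 :=
    continuous_const.mul (contInt (by fun_prop))
  have bG : ∫ x in (0 : ℝ)..L, h * ∫ r in (-h)..(0 : ℝ), px v (x, r) ^ 2 ≤ h * V ^ 2 := by
    rw [intervalIntegral.integral_const_mul,
      ← rect_eq hL hh (f := fun q => px v q ^ 2) (by fun_prop)]
    have := n1.2.2.2.2.2.1
    have nn : 0 ≤ ∫ q in rect L h, pz v q ^ 2 := rect_nonneg fun q => sq_nonneg _
    exact mul_le_mul_of_nonneg_left (by linarith) hh.le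
  have bz : ∀ (g w : ℝ × ℝ → ℝ), Continuous g → Continuous w →
      (∀ x ∈ Icc 0 L, ∫ z in (-h)..(0 : ℝ), w (x, z) ^ 2 ≤ K * Hh * Vh) →
      √(∫ q in rect L h, g q ^ 2) ≤ D →
      |∫ q in rect L h, Phi h v q * g q * w q| ≤ D * (√(h * K) * V * √Hh * √Vh) := by
    intro g w hg hw hS hgV
    refine (tri_bound hL hh cPhi hg hw cG
      (fun x _ z hz => Phi_bound hv x z hz) hS).trans ?_
    refine mul_le_mul hgV ?_ (Real.sqrt_nonneg _) p6
    rw [← Real.sqrt_sq (show 0 ≤ √(h * K) * V * √Hh * √Vh by positivity), ← s1]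
    exact Real.sqrt_le_sqrt (mul_le_mul_of_nonneg_right bG (by positivity))
  have q1 := n2.2.2.2.2.2.1
  have q2 := n2.2.2.2.2.2.2.2.1
  have q3 := n2.2.2.2.2.2.2.2.2.1
  have q4 := n2.2.2.2.2.2.2.2.2.2
  have nn1 : 0 ≤ ∫ q in rect L h, pz vt q ^ 2 := rect_nonneg fun q => sq_nonneg _
  have nn2 : 0 ≤ ∫ q in rect L h, pz Tt q ^ 2 := rect_nonneg fun q => sq_nonneg _
  have t1 := bx (px vt) vh cvtx cvh gvh.1 (Real.sqrt_le_iff.2 ⟨p5, by linarith⟩)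
  have t2 := bx (px Tt) φ cTtx cφ gφ.1 (Real.sqrt_le_iff.2 ⟨p5, by linarith⟩)
  have t3 := bz (pz vt) vh cvtz cvh gvh.1 (Real.sqrt_le_iff.2 ⟨p6, q3⟩)
  have t4 := bz (pz Tt) φ cTtz cφ gφ.1 (Real.sqrt_le_iff.2 ⟨p6, q4⟩)
  rw [dec]
  rw [abs_le] at t1 t2 t3 t4
  have u1 : 0 ≤ √(h * K) * Vt * √H * √V * √Hh * √Vh := by positivity
  have u2 : 0 ≤ K * D * V * √Hh * √Vh := by positivity
  rw [abs_le]
  constructor <;> linarith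
end
end
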